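/- Breaking the designated equality: assume rk(M i) < rk(s) for every i : ι, and suppose x̄, ȳ : ι satisfy t ∈ N x̄ and t ∉ N ȳ. Then for every n ∈ ℕ, s ∈ Mₙ x̄ and s ∉ Mₙ ȳ; in particular Mₙ x̄ ≠ Mₙ ȳ. -/

import Mathlib

-- The recursive enlargement construction from the convexity proof for MLS:
-- `mlsStage M N s t n = (Vₙ, Mₙ)`, where
-- `V₀ = {u | t ∈ N u}`, `Vₙ₊₁ = {u | ∃ v ∈ Vₙ, M v ∈ M u}`,
-- `M₀ u = M u ∪ {s}` if `u ∈ V₀` and `M u` otherwise, and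
-- `Mₙ₊₁ u = Mₙ u ∪ {Mₙ v | v ∈ Vₙ ∧ M v ∈ M u}` if `u ∈ Vₙ₊₁` and `Mₙ u` otherwise.
open Classical in
noncomputable def mlsStage {ι : Type} [Fintype ι] (M N : ι → ZFSet) (s t : ZFSet) :
    ℕ → Set ι × (ι → ZFSet)
  | 0 => ({u | t ∈ N u}, fun u => if t ∈ N u then M u ∪ {s} else M u)
  | n + 1 =>
      let P := mlsStage M N s t n
      ({u | ∃ v ∈ P.1, M v ∈ M u},
        fun u =>
          if ∃ v ∈ P.1, M v ∈ M u then
            P.2 u ∪ ZFSet.range (fun v : {v : ι // v ∈ P.1 ∧ M v ∈ M u} => P.2 v.1)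
          else P.2 u)

/-- `Vₙ`, the set of variables modified at stage `n`. -/
noncomputable def mlsV {ι : Type} [Fintype ι] (M N : ι → ZFSet) (s t : ZFSet) (n : ℕ) :
    Set ι :=
  (mlsStage M N s t n).1

/-- `Mₙ`, the enlarged assignment at stage `n`. -/
noncomputable def mlsM {ι : Type} [Fintype ι] (M N : ι → ZFSet) (s t : ZFSet) (n : ℕ) :
    ι → ZFSet :=
  (mlsStage M N s t n).2

/-- Variables modified at stage `n` have rank above `s` at that stage. -/
theorem rank_lt_rank_mlsM {ι : Type} [Fintype ι] (M N : ι → ZFSet) (s t : ZFSet) (n : ℕ)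
    {v : ι} (hv : v ∈ mlsV M N s t n) : s.rank < (mlsM M N s t n v).rank := by
  induction n generalizing v with
  | zero =>
    have hv' : t ∈ N v := hv
    exact ZFSet.rank_lt_of_mem (by simp [mlsM, mlsStage, hv'])
  | succ n ih =>
    have hv' : ∃ w ∈ (mlsStage M N s t n).1, M w ∈ M v := hv
    obtain ⟨w, hw, hwv⟩ := hv'
    refine (ih hw).trans (ZFSet.rank_lt_of_mem ?_)
    simp only [mlsM, mlsStage]
    rw [if_pos ⟨w, hw, hwv⟩, ZFSet.mem_union]
    exact Or.inr (ZFSet.mem_range.2 ⟨⟨w, hw, hwv⟩, rfl⟩)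

/-- The stages after the first neither add nor remove `s`. -/
theorem mem_mlsM_succ_iff {ι : Type} [Fintype ι] (M N : ι → ZFSet) (s t : ZFSet) (n : ℕ)
    (u : ι) : s ∈ mlsM M N s t (n + 1) u ↔ s ∈ mlsM M N s t n u := by
  simp only [mlsM, mlsStage]
  split_ifs
  · rw [ZFSet.mem_union, or_iff_left]
    intro h
    obtain ⟨⟨v, hv, _⟩, hvs⟩ := ZFSet.mem_range.1 h
    exact (rank_lt_rank_mlsM M N s t n hv).ne' (congrArg ZFSet.rank hvs)
  · rfl

/-- When all `M i` have rank below `s`, membership of `s` in `Mₙ u` is governed by `V₀`. -/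
theorem mem_mlsM_iff {ι : Type} [Fintype ι] (M N : ι → ZFSet) (s t : ZFSet)
    (hrk : ∀ i : ι, (M i).rank < s.rank) (n : ℕ) (u : ι) :
    s ∈ mlsM M N s t n u ↔ t ∈ N u := by
  induction n with
  | zero =>
    have hs : s ∉ M u := fun h => (hrk u).asymm (ZFSet.rank_lt_of_mem h)
    by_cases h : t ∈ N u <;> simp [mlsM, mlsStage, h, hs]
  | succ n ih => rw [mem_mlsM_succ_iff, ih]

/-- Breaking the designated equality: if `t ∈ N x̄` and `t ∉ N ȳ`, then for every `n`,
`s ∈ Mₙ x̄`, `s ∉ Mₙ ȳ`, and in particular `Mₙ x̄ ≠ Mₙ ȳ`. -/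
theorem mlsM_breaks_equality {ι : Type} [Fintype ι] (M N : ι → ZFSet) (s t : ZFSet)
    (hrk : ∀ i : ι, (M i).rank < s.rank)
    (xb yb : ι) (hx : t ∈ N xb) (hy : t ∉ N yb) :
    ∀ n : ℕ, s ∈ mlsM M N s t n xb ∧ s ∉ mlsM M N s t n yb ∧
      mlsM M N s t n xb ≠ mlsM M N s t n yb := by
  intro n
  have hxs := (mem_mlsM_iff M N s t hrk n xb).2 hx
  have hys := mt (mem_mlsM_iff M N s t hrk n yb).1 hy
  exact ⟨hxs, hys, fun h => hys (h ▸ hxs)⟩
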